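/- Let {Π_{ik}} be a measurement design on ℂ^q with Gram superoperator G, and set q̄ := (1/n) Σ_{i=1}^n q_i and α := ((q̄−1)/(q−1))·(1/(q+1)). Then: (1) the trace of G as a real-linear endomorphism of the real vector space of Hermitian q×q matrices equals q̄; (2) the traceless Hermitian matrices form a G-invariant subspace, and the smallest eigenvalue of the restriction of G to this subspace is at most α, with equality if and only if the design is α-unitary. -/

import Mathlib

open Matrix Finset

noncomputable section

/-- The Gram superoperator `G[S] = (1/n) Σ_i Σ_k (tr(S Π_{ik})/m_{ik}) Π_{ik}`. -/
def gramOf {q n : ℕ} (out : Fin n → ℕ)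
    (P : (i : Fin n) → Fin (out i) → Matrix (Fin q) (Fin q) ℂ)
    (S : Matrix (Fin q) (Fin q) ℂ) : Matrix (Fin q) (Fin q) ℂ :=
  (n : ℂ)⁻¹ • ∑ i, ∑ k, ((S * P i k).trace / (P i k).trace) • P i k

theorem LinearMap.trace_eq_trace_restrict_ker_add_one {V : Type*} [AddCommGroup V] [Module ℝ V]
    [FiniteDimensional ℝ V] (T : V →ₗ[ℝ] V) (f : V →ₗ[ℝ] ℝ) {v : V} (hv : f v = 1) (hT : T v = v)
    (hinv : ∀ x ∈ LinearMap.ker f, T x ∈ LinearMap.ker f) :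
    LinearMap.trace ℝ V T = LinearMap.trace ℝ (LinearMap.ker f) (T.restrict hinv) + 1 := by
  let proj : V →ₗ[ℝ] LinearMap.ker f :=
    (LinearMap.id - f.smulRight v).codRestrict (LinearMap.ker f) (by intro x; simp [hv])
  have hcoe (x : V) : (proj x : V) = x - f x • v := rfl
  have hdecomp : T = ((LinearMap.ker f).subtype ∘ₗ T.restrict hinv) ∘ₗ proj + f.smulRight v := by
    ext x
    simp [hcoe, hT]
  have hproj : proj ∘ₗ (LinearMap.ker f).subtype = LinearMap.id := by
    ext x
    simp [hcoe]
  conv_lhs => rw [hdecomp]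
  rw [map_add, LinearMap.trace_smulRight, hv, LinearMap.trace_comp_comm', ← LinearMap.comp_assoc,
    hproj, LinearMap.id_comp]

section Spectral

variable {E : Type*} [NormedAddCommGroup E] [InnerProductSpace ℝ E] [FiniteDimensional ℝ E]
  {T : E →ₗ[ℝ] E}

namespace LinearMap.IsSymmetric

theorem sInf_hasEigenvalue_le_eigenvalues (hT : T.IsSymmetric)
    (i : Fin (Module.finrank ℝ E)) :
    sInf {μ : ℝ | Module.End.HasEigenvalue T μ} ≤ hT.eigenvalues rfl i :=
  csInf_le (Module.End.finite_hasEigenvalue T).bddBelow (hT.hasEigenvalue_eigenvalues rfl i)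

theorem trace_eq_sum_real_eigenvalues (hT : T.IsSymmetric) :
    LinearMap.trace ℝ E T = ∑ i, hT.eigenvalues rfl i := by
  simpa using hT.trace_eq_sum_eigenvalues rfl

theorem sInf_hasEigenvalue_le_trace_div_finrank [Nontrivial E] (hT : T.IsSymmetric) :
    sInf {μ : ℝ | Module.End.HasEigenvalue T μ} ≤
      LinearMap.trace ℝ E T / Module.finrank ℝ E := by
  have hd : (0 : ℝ) < Module.finrank ℝ E := by exact_mod_cast Module.finrank_pos
  rw [le_div_iff₀ hd, hT.trace_eq_sum_real_eigenvalues, mul_comm]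
  simpa using Finset.card_nsmul_le_sum Finset.univ (hT.eigenvalues rfl) _
    fun i _ ↦ hT.sInf_hasEigenvalue_le_eigenvalues i

theorem sInf_hasEigenvalue_eq_trace_div_finrank_iff [Nontrivial E] (hT : T.IsSymmetric) :
    sInf {μ : ℝ | Module.End.HasEigenvalue T μ} =
      LinearMap.trace ℝ E T / Module.finrank ℝ E ↔
    ∀ x, T x = (LinearMap.trace ℝ E T / Module.finrank ℝ E) • x := by
  have hd : (0 : ℝ) < Module.finrank ℝ E := by exact_mod_cast Module.finrank_pos
  set c := LinearMap.trace ℝ E T / Module.finrank ℝ E with hc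
  constructor
  · intro h
    have hle : ∀ i ∈ Finset.univ, c ≤ hT.eigenvalues rfl i := fun i _ ↦
      h ▸ hT.sInf_hasEigenvalue_le_eigenvalues i
    have hsum : ∑ _i : Fin (Module.finrank ℝ E), c = ∑ i, hT.eigenvalues rfl i := by
      rw [← hT.trace_eq_sum_real_eigenvalues, hc]
      simp [mul_div_cancel₀ _ hd.ne']
    have heq := (Finset.sum_eq_sum_iff_of_le hle).1 hsum
    have hTc : T = c • LinearMap.id := by
      refine (hT.eigenvectorBasis rfl).toBasis.ext fun i ↦ ?_
      simp [hT.apply_eigenvectorBasis, ← heq i (Finset.mem_univ i)]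
    intro x
    simp [congrArg (· x) hTc]
  · intro h
    have hset : {μ : ℝ | Module.End.HasEigenvalue T μ} = {c} := by
      ext μ
      constructor
      · intro hμ
        obtain ⟨v, hv⟩ := hμ.exists_hasEigenvector
        have := hv.apply_eq_smul
        rw [h v] at this
        exact (smul_left_injective ℝ hv.2 this).symm
      · rintro rfl
        obtain ⟨v, hv⟩ := exists_ne (0 : E)
        exact Module.End.hasEigenvalue_of_hasEigenvector
          ⟨Module.End.mem_eigenspace_iff.2 (h v), hv⟩
    rw [hset, csInf_singleton]

end LinearMap.IsSymmetric

end Spectral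

/-- The space of Hermitian matrices, as a real vector space. -/
abbrev HermitianSpace (q : ℕ) : Type := selfAdjoint (Matrix (Fin q) (Fin q) ℂ)

instance (q : ℕ) : FiniteDimensional ℝ (HermitianSpace q) :=
  inferInstanceAs (FiniteDimensional ℝ (selfAdjoint.submodule ℝ (Matrix (Fin q) (Fin q) ℂ)))

theorem finrank_hermitianSpace (q : ℕ) : Module.finrank ℝ (HermitianSpace q) = q ^ 2 := by
  let e : (HermitianSpace q × HermitianSpace q) ≃ₗ[ℝ] Matrix (Fin q) (Fin q) ℂ :=
    { toFun := fun x ↦ (x.1 : Matrix (Fin q) (Fin q) ℂ) + Complex.I • (x.2 : Matrix _ _ ℂ)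
      invFun := fun A ↦ (realPart A, imaginaryPart A)
      map_add' := fun x y ↦ by
        simp only [Prod.fst_add, Prod.snd_add, AddSubgroup.coe_add, smul_add]; abel
      map_smul' := fun c x ↦ by
        simp [smul_comm c Complex.I]
      left_inv := fun x ↦ by
        have h₁ := x.1.2.imaginaryPart
        have h₂ := x.2.2.imaginaryPart
        ext1 <;> simp [realPart_I_smul, imaginaryPart_I_smul, h₁, h₂]
      right_inv := fun A ↦ realPart_add_I_smul_imaginaryPart A }
  have h := e.finrank_eq
  rw [Module.finrank_prod, Module.finrank_matrix, Complex.finrank_real_complex] at h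
  simp only [Fintype.card_fin] at h
  nlinarith

/-- The functional `S ↦ Re tr(S A)`. -/
def traceMulRe {q : ℕ} (A : Matrix (Fin q) (Fin q) ℂ) : HermitianSpace q →ₗ[ℝ] ℝ where
  toFun S := ((S : Matrix (Fin q) (Fin q) ℂ) * A).trace.re
  map_add' S S' := by simp [add_mul]
  map_smul' c S := by simp

theorem traceMulRe_apply {q : ℕ} (A : Matrix (Fin q) (Fin q) ℂ) (S : HermitianSpace q) :
    traceMulRe A S = ((S : Matrix (Fin q) (Fin q) ℂ) * A).trace.re := rfl

theorem Matrix.IsHermitian.ofReal_re_trace_mul {q : ℕ} {A B : Matrix (Fin q) (Fin q) ℂ}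
    (hA : A.IsHermitian) (hB : B.IsHermitian) : (((A * B).trace.re : ℝ) : ℂ) = (A * B).trace := by
  rw [← Complex.conj_eq_iff_re, starRingEnd_apply, ← trace_conjTranspose,
    conjTranspose_mul, hA.eq, hB.eq, trace_mul_comm]

theorem traceMulRe_comm {q : ℕ} (A B : HermitianSpace q) :
    traceMulRe (A : Matrix (Fin q) (Fin q) ℂ) B = traceMulRe (B : Matrix (Fin q) (Fin q) ℂ) A := by
  rw [traceMulRe_apply, traceMulRe_apply, trace_mul_comm]

open scoped ComplexOrder in
/-- The Frobenius inner product on a real space of Hermitian matrices. -/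
abbrev frobeniusCore {q : ℕ} (W : Submodule ℝ (HermitianSpace q)) :
    InnerProductSpace.Core ℝ W where
  inner x y := traceMulRe (y.1 : Matrix (Fin q) (Fin q) ℂ) x.1
  conj_inner_symm x y := traceMulRe_comm x.1 y.1
  re_inner_nonneg x := by
    have h := (posSemidef_conjTranspose_mul_self (x.1 : Matrix (Fin q) (Fin q) ℂ)).trace_nonneg
    have hx : (x.1 : Matrix (Fin q) (Fin q) ℂ)ᴴ = x.1 := x.1.2
    rw [hx] at h
    exact (Complex.le_def.1 h).1
  add_left x y z := by simp
  smul_left x y r := by simp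
  definite x h := by
    have hx : (x.1 : Matrix (Fin q) (Fin q) ℂ)ᴴ = x.1 := x.1.2
    have h' : ((x.1 : Matrix (Fin q) (Fin q) ℂ)ᴴ * (x.1 : Matrix (Fin q) (Fin q) ℂ)).trace = 0 := by
      have h₂ := Matrix.IsHermitian.ofReal_re_trace_mul hx hx
      rw [traceMulRe_apply] at h
      rw [hx, ← h₂, h, Complex.ofReal_zero]
    rw [trace_conjTranspose_mul_self_eq_zero_iff] at h'
    exact Subtype.ext (Subtype.ext h')

section Design

variable {q n : ℕ} {out : Fin n → ℕ} {P : (i : Fin n) → Fin (out i) → Matrix (Fin q) (Fin q) ℂ}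

/-- The Gram superoperator as a real-linear endomorphism of the Hermitian matrices. -/
def gramHermitian (hherm : ∀ i k, (P i k).IsHermitian) :
    HermitianSpace q →ₗ[ℝ] HermitianSpace q :=
  ∑ i, ∑ k, (((n : ℝ)⁻¹ * (P i k).trace.re⁻¹) • traceMulRe (P i k)).smulRight
    (⟨P i k, hherm i k⟩ : HermitianSpace q)

theorem ofReal_re_trace {A : Matrix (Fin q) (Fin q) ℂ} (hA : A.IsHermitian) :
    ((A.trace.re : ℝ) : ℂ) = A.trace := by
  simpa using hA.ofReal_re_trace_mul isHermitian_one

open scoped ComplexOrder in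
theorem trace_ne_zero_of_isHermitian_of_mul_self {A : Matrix (Fin q) (Fin q) ℂ}
    (hA : A.IsHermitian) (hA' : A * A = A) (h0 : A ≠ 0) : A.trace ≠ 0 := by
  rw [← hA']
  nth_rewrite 1 [← hA.eq]
  rwa [Ne, trace_conjTranspose_mul_self_eq_zero_iff]

theorem coe_gramHermitian (hherm : ∀ i k, (P i k).IsHermitian) (S : HermitianSpace q) :
    (gramHermitian hherm S : Matrix (Fin q) (Fin q) ℂ) = gramOf out P S := by
  simp only [gramHermitian, gramOf, LinearMap.sum_apply, AddSubgroup.val_finsetSum,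
    Finset.smul_sum]
  refine Finset.sum_congr rfl fun i _ ↦ Finset.sum_congr rfl fun k _ ↦ ?_
  have hS : (S : Matrix (Fin q) (Fin q) ℂ).IsHermitian := S.2
  rw [← hS.ofReal_re_trace_mul (hherm i k), ← ofReal_re_trace (hherm i k)]
  ext a b
  simp [traceMulRe_apply, div_eq_mul_inv]
  ring

theorem trace_gramHermitian (hherm : ∀ i k, (P i k).IsHermitian)
    (hproj : ∀ i k, P i k * P i k = P i k) (hP0 : ∀ i k, P i k ≠ 0) :
    LinearMap.trace ℝ _ (gramHermitian hherm) = (∑ i, (out i : ℝ)) / n := by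
  have hre : ∀ i k, (P i k).trace.re ≠ 0 := fun i k h ↦
    trace_ne_zero_of_isHermitian_of_mul_self (hherm i k) (hproj i k) (hP0 i k)
      (by rw [← ofReal_re_trace (hherm i k), h, Complex.ofReal_zero])
  have hterm i k : LinearMap.trace ℝ (HermitianSpace q)
      ((((n : ℝ)⁻¹ * (P i k).trace.re⁻¹) • traceMulRe (P i k)).smulRight
        (⟨P i k, hherm i k⟩ : HermitianSpace q)) = (n : ℝ)⁻¹ := by
    rw [LinearMap.trace_smulRight, LinearMap.smul_apply, traceMulRe_apply, hproj, smul_eq_mul,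
      mul_assoc, inv_mul_cancel₀ (hre i k), mul_one]
  simp only [gramHermitian, map_sum, hterm]
  simp [div_eq_mul_inv, Finset.sum_mul]

theorem trace_gramOf (hn : 1 ≤ n) (hherm : ∀ i k, (P i k).IsHermitian)
    (hproj : ∀ i k, P i k * P i k = P i k) (hsum : ∀ i, ∑ k, P i k = 1)
    (hP0 : ∀ i k, P i k ≠ 0) (S : Matrix (Fin q) (Fin q) ℂ) :
    (gramOf out P S).trace = S.trace := by
  have hn' : (n : ℂ) ≠ 0 := by exact_mod_cast (by omega : n ≠ 0)
  have h : ∀ i, ∑ k, (S * P i k).trace = S.trace := fun i ↦ by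
    rw [← trace_sum, ← Finset.mul_sum, hsum, mul_one]
  have htr i k := trace_ne_zero_of_isHermitian_of_mul_self (hherm i k) (hproj i k) (hP0 i k)
  simp [gramOf, trace_sum, trace_smul, div_mul_cancel₀ _ (htr _ _), h, hn']

theorem gramOf_one (hn : 1 ≤ n) (hherm : ∀ i k, (P i k).IsHermitian)
    (hproj : ∀ i k, P i k * P i k = P i k) (hsum : ∀ i, ∑ k, P i k = 1)
    (hP0 : ∀ i k, P i k ≠ 0) : gramOf out P 1 = 1 := by
  have hn' : (n : ℂ) ≠ 0 := by exact_mod_cast (by omega : n ≠ 0)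
  have htr i k := trace_ne_zero_of_isHermitian_of_mul_self (hherm i k) (hproj i k) (hP0 i k)
  simp only [gramOf, one_mul, div_self (htr _ _), one_smul, hsum, Finset.sum_const,
    Finset.card_univ, Fintype.card_fin, ← Nat.cast_smul_eq_nsmul ℂ, smul_smul,
    inv_mul_cancel₀ hn']

theorem traceMulRe_gramHermitian_comm (hherm : ∀ i k, (P i k).IsHermitian)
    (A B : HermitianSpace q) :
    traceMulRe (B : Matrix (Fin q) (Fin q) ℂ) (gramHermitian hherm A) =
      traceMulRe (gramHermitian hherm B : Matrix (Fin q) (Fin q) ℂ) A := by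
  rw [traceMulRe_comm _ A]
  simp only [gramHermitian, LinearMap.sum_apply, map_sum, LinearMap.smulRight_apply, map_smul]
  refine Finset.sum_congr rfl fun i _ ↦ Finset.sum_congr rfl fun k _ ↦ ?_
  rw [traceMulRe_comm B ⟨P i k, hherm i k⟩, traceMulRe_comm A ⟨P i k, hherm i k⟩]
  simp only [LinearMap.smul_apply, smul_eq_mul]
  ring

end Design

/-- For a measurement design with Gram superoperator `G`, setting
`q̄ = (1/n) Σ_i q_i` and `α = ((q̄−1)/(q−1))·(1/(q+1))`:
(1) the trace of `G` as a real-linear endomorphism of the Hermitian matrices equals `q̄`;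
(2) the traceless Hermitian matrices form a `G`-invariant subspace, and the smallest
eigenvalue of the restriction of `G` to this subspace is at most `α`, with equality if and
only if the design is `α`-unitary. -/
theorem gram_trace_and_min_eigenvalue
    (q n : ℕ) (hq : 2 ≤ q) (hn : 1 ≤ n)
    (out : Fin n → ℕ) (hout : ∀ i, 2 ≤ out i)
    (P : (i : Fin n) → Fin (out i) → Matrix (Fin q) (Fin q) ℂ)
    (hherm : ∀ i k, (P i k).IsHermitian)
    (hproj : ∀ i k, P i k * P i k = P i k)
    (horth : ∀ i (k k' : Fin (out i)), k ≠ k' → P i k * P i k' = 0)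
    (hsum : ∀ i, ∑ k, P i k = 1)
    (hP0 : ∀ i k, P i k ≠ 0) :
    (∀ G' : ↥(selfAdjoint (Matrix (Fin q) (Fin q) ℂ)) →ₗ[ℝ]
            ↥(selfAdjoint (Matrix (Fin q) (Fin q) ℂ)),
      (∀ S : ↥(selfAdjoint (Matrix (Fin q) (Fin q) ℂ)),
          (↑(G' S) : Matrix (Fin q) (Fin q) ℂ) = gramOf out P ↑S) →
      LinearMap.trace ℝ _ G' = (∑ i, (out i : ℝ)) / n)
    ∧
    (∀ Δ : Matrix (Fin q) (Fin q) ℂ, Δ.IsHermitian → Δ.trace = 0 →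
      (gramOf out P Δ).IsHermitian ∧ (gramOf out P Δ).trace = 0)
    ∧
    (sInf {μ : ℝ | ∃ Δ : Matrix (Fin q) (Fin q) ℂ,
        Δ ≠ 0 ∧ Δ.IsHermitian ∧ Δ.trace = 0 ∧ gramOf out P Δ = (μ : ℂ) • Δ}
      ≤ (((∑ i, (out i : ℝ)) / n - 1) / ((q : ℝ) - 1)) * (1 / ((q : ℝ) + 1)))
    ∧
    (sInf {μ : ℝ | ∃ Δ : Matrix (Fin q) (Fin q) ℂ,
        Δ ≠ 0 ∧ Δ.IsHermitian ∧ Δ.trace = 0 ∧ gramOf out P Δ = (μ : ℂ) • Δ}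
      = (((∑ i, (out i : ℝ)) / n - 1) / ((q : ℝ) - 1)) * (1 / ((q : ℝ) + 1))
      ↔
      (∀ Δ : Matrix (Fin q) (Fin q) ℂ, Δ.IsHermitian → Δ.trace = 0 →
        gramOf out P Δ =
          (((((∑ i, (out i : ℝ)) / n - 1) / ((q : ℝ) - 1)) * (1 / ((q : ℝ) + 1)) : ℝ) : ℂ) • Δ)) := by
  have hq0 : (q : ℝ) ≠ 0 := by positivity
  have hq1 : (2 : ℝ) ≤ q := by exact_mod_cast hq
  let G := gramHermitian hherm
  let f : HermitianSpace q →ₗ[ℝ] ℝ := (q : ℝ)⁻¹ • traceMulRe 1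
  have hmem (S : HermitianSpace q) :
      S ∈ LinearMap.ker f ↔ (S : Matrix (Fin q) (Fin q) ℂ).trace = 0 := by
    have hS : (S : Matrix (Fin q) (Fin q) ℂ).IsHermitian := S.2
    rw [← ofReal_re_trace hS]
    simp [f, traceMulRe_apply, hq0]
  have hinv : ∀ S ∈ LinearMap.ker f, G S ∈ LinearMap.ker f := fun S hS ↦ by
    rw [hmem] at hS ⊢
    rw [coe_gramHermitian, trace_gramOf hn hherm hproj hsum hP0, hS]
  let T := G.restrict hinv
  have hf1 : f 1 = 1 := by simp [f, traceMulRe_apply, hq0]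
  have hG1 : G 1 = 1 := Subtype.ext <| by
    rw [coe_gramHermitian]
    exact gramOf_one hn hherm hproj hsum hP0
  have htrG : LinearMap.trace ℝ _ G = (∑ i, (out i : ℝ)) / n :=
    trace_gramHermitian hherm hproj hP0
  have htrT : LinearMap.trace ℝ _ T = (∑ i, (out i : ℝ)) / n - 1 := by
    rw [← htrG, LinearMap.trace_eq_trace_restrict_ker_add_one G f hf1 hG1 hinv, add_sub_cancel_right]
  have hfin : (Module.finrank ℝ (LinearMap.ker f) : ℝ) = (q - 1) * (q + 1) := by
    have hsurj : LinearMap.range f = ⊤ := LinearMap.range_eq_top.2 fun c ↦ ⟨c • 1, by simp [hf1]⟩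
    have h := f.finrank_range_add_finrank_ker
    rw [hsurj, finrank_top, Module.finrank_self, finrank_hermitianSpace] at h
    have h' : (1 : ℝ) + Module.finrank ℝ (LinearMap.ker f) = q ^ 2 := by exact_mod_cast h
    linarith
  have hmean : LinearMap.trace ℝ _ T / Module.finrank ℝ (LinearMap.ker f) =
      (((∑ i, (out i : ℝ)) / n - 1) / ((q : ℝ) - 1)) * (1 / ((q : ℝ) + 1)) := by
    rw [htrT, hfin, div_mul_div_comm, mul_one]
  have : Nontrivial (LinearMap.ker f) := by
    refine Module.nontrivial_of_finrank_pos (R := ℝ) ?_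
    have : (0 : ℝ) < Module.finrank ℝ (LinearMap.ker f) := by rw [hfin]; nlinarith
    exact_mod_cast this
  have hTiff (Δ : LinearMap.ker f) (μ : ℝ) : T Δ = μ • Δ ↔
      gramOf out P Δ.1 = (μ : ℂ) • (Δ.1 : Matrix (Fin q) (Fin q) ℂ) := by
    rw [← coe_gramHermitian hherm, Complex.coe_smul, Subtype.ext_iff, Subtype.ext_iff]
    rfl
  have hset : {μ : ℝ | ∃ Δ : Matrix (Fin q) (Fin q) ℂ,
      Δ ≠ 0 ∧ Δ.IsHermitian ∧ Δ.trace = 0 ∧ gramOf out P Δ = (μ : ℂ) • Δ} =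
      {μ : ℝ | Module.End.HasEigenvalue T μ} := by
    ext μ
    constructor
    · rintro ⟨Δ, h0, hΔ, htr, hμ⟩
      refine Module.End.hasEigenvalue_of_hasEigenvector (x := ⟨⟨Δ, hΔ⟩, (hmem _).2 htr⟩)
        ⟨Module.End.mem_eigenspace_iff.2 ((hTiff _ _).2 hμ), fun h ↦ h0 ?_⟩
      exact congrArg (fun x : LinearMap.ker f ↦ (x.1 : Matrix (Fin q) (Fin q) ℂ)) h
    · intro hμ
      obtain ⟨Δ, hΔ⟩ := hμ.exists_hasEigenvector
      exact ⟨Δ.1, fun h ↦ hΔ.2 (Subtype.ext (Subtype.ext h)), Δ.1.2, (hmem _).1 Δ.2,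
        (hTiff _ _).1 hΔ.apply_eq_smul⟩
  let _ : NormedAddCommGroup (LinearMap.ker f) :=
    (frobeniusCore (LinearMap.ker f)).toNormedAddCommGroup
  let _ : InnerProductSpace ℝ (LinearMap.ker f) := InnerProductSpace.ofCore _
  have hsymm : T.IsSymmetric := fun A B ↦ (traceMulRe_gramHermitian_comm hherm A.1 B.1)
  refine ⟨fun G' hG' ↦ ?_, fun Δ hΔ htr ↦ ⟨?_, ?_⟩, ?_, ?_⟩
  · rw [← htrG]
    congr 1
    ext1 S
    exact Subtype.ext ((hG' S).trans (coe_gramHermitian hherm S).symm)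
  · rw [← coe_gramHermitian hherm ⟨Δ, hΔ⟩]
    exact (gramHermitian hherm ⟨Δ, hΔ⟩).2
  · rw [trace_gramOf hn hherm hproj hsum hP0, htr]
  · rw [hset, ← hmean]
    exact hsymm.sInf_hasEigenvalue_le_trace_div_finrank
  · rw [hset, ← hmean]
    refine hsymm.sInf_hasEigenvalue_eq_trace_div_finrank_iff.trans ⟨fun h Δ hΔ htr ↦ ?_,
      fun h Δ ↦ (hTiff _ _).2 (h _ Δ.1.2 ((hmem _).1 Δ.2))⟩
    exact (hTiff ⟨⟨Δ, hΔ⟩, (hmem _).2 htr⟩ _).1 (h _)
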